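/- Let Γ_N denote the set of σ ∈ R^{n+1} such that (i) there exist natural numbers N_{ij} (i, j ∈ I) with σ_i = 2∑_{j∈I} N_{ij} X_j for all i ∈ I, and (ii) σ satisfies the Pohozaev identity as an identity of polynomials: ∑_{i=1}^{n+1} σ_i² − ∑_{i=1}^{n+1} σ_i σ_{i+1} = 2∑_{i=1}^{n+1} X_i σ_i (with σ_{n+2} = σ_1). Then Γ_N = Γ_A. -/

import Mathlib

open Finset

/-- The generalized Cartan matrix of type `A_n^{(1)}`, with indices read cyclically
(`K i i = 2`, `K i j = -1` when `i,j` are cyclically adjacent, `0` otherwise). -/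
noncomputable def affA (n : ℕ) (i j : ZMod (n + 1)) : ℝ :=
  if i = j then 2 else if i = j + 1 ∨ j = i + 1 then -1 else 0

/-- The polynomial affine reflection `ℜ_i` on `R^{n+1}`, `R = ℝ[X_1,…,X_{n+1}]`:
`(ℜ_i σ)_i = 2 X_i - ∑_t K_{i t} σ_t + σ_i` and `(ℜ_i σ)_j = σ_j` for `j ≠ i`. -/
noncomputable def reflAP (n : ℕ) (i : ZMod (n + 1))
    (σ : ZMod (n + 1) → MvPolynomial (ZMod (n + 1)) ℝ) :
    ZMod (n + 1) → MvPolynomial (ZMod (n + 1)) ℝ :=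
  Function.update σ i
    (2 * MvPolynomial.X i
      - ∑ t : ZMod (n + 1), MvPolynomial.C (affA n i t) * σ t + σ i)

/-- `Γ_A` (polynomial version): the smallest subset of `R^{n+1}` containing `0`
and closed under all `ℜ_i`. -/
inductive GammaAP (n : ℕ) : (ZMod (n + 1) → MvPolynomial (ZMod (n + 1)) ℝ) → Prop
  | zero : GammaAP n 0
  | refl (i : ZMod (n + 1)) (σ : ZMod (n + 1) → MvPolynomial (ZMod (n + 1)) ℝ) :
      GammaAP n σ → GammaAP n (reflAP n i σ)

/-- The cyclic sum of absolute differences dominates twice any difference of two values. -/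
theorem two_mul_sub_le_sum_abs_sub (n : ℕ) (c : ZMod (n + 1) → ℤ) (j k : ZMod (n + 1)) :
    2 * (c j - c k) ≤ ∑ i, |c i - c (i + 1)| := by
  obtain ⟨a, ha, rfl⟩ : ∃ a : ℕ, a ≤ n + 1 ∧ k + (a : ZMod (n + 1)) = j :=
    ⟨(j - k).val, (ZMod.val_lt _).le, by rw [ZMod.natCast_zmod_val]; ring⟩
  set g : ℕ → ℤ := fun t => c (k + (t : ZMod (n + 1))) with hg
  have hsum : ∑ i, |c i - c (i + 1)| = ∑ t ∈ range (n + 1), |g t - g (t + 1)| := by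
    rw [← Equiv.sum_comp (Equiv.addLeft k)]
    rw [← Fin.sum_univ_eq_sum_range (fun t => |g t - g (t + 1)|)]
    refine Finset.sum_congr rfl fun x _ => ?_
    have hx : ((Fin.val (n := n + 1) x : ℕ) : ZMod (n + 1)) = x :=
      ZMod.natCast_zmod_val (n := n + 1) x
    simp only [hg, Equiv.coe_addLeft, Nat.cast_add, Nat.cast_one, hx, add_assoc]
  have hlast : g (n + 1) = g 0 := by
    have : ((n + 1 : ℕ) : ZMod (n + 1)) = 0 := ZMod.natCast_self _
    simp only [hg, this, Nat.cast_zero]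
  have hzero : g 0 = c k := by simp [hg]
  have htel : ∀ b, g (a + b) - g a = ∑ t ∈ range b, (g (a + t + 1) - g (a + t)) := fun b =>
    (Finset.sum_range_sub (fun t => g (a + t)) b).symm
  obtain ⟨b, hb⟩ := Nat.exists_eq_add_of_le ha
  have h₁ : g a - g 0 ≤ ∑ t ∈ range a, |g t - g (t + 1)| := by
    rw [← Finset.sum_range_sub]
    exact Finset.sum_le_sum fun t _ => by
      rw [abs_sub_comm]
      exact le_abs_self _
  have h₂ : g a - g (a + b) ≤ ∑ t ∈ range b, |g (a + t) - g (a + t + 1)| := by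
    rw [← neg_sub, htel, ← Finset.sum_neg_distrib]
    exact Finset.sum_le_sum fun t _ => by
      rw [neg_sub]
      exact le_abs_self _
  have hsplit : ∑ t ∈ range (n + 1), |g t - g (t + 1)| = ∑ t ∈ range a, |g t - g (t + 1)|
      + ∑ t ∈ range b, |g (a + t) - g (a + t + 1)| := by
    rw [← Finset.sum_range_add (fun t => |g t - g (t + 1)|), ← hb]
  have hab : g (a + b) = g 0 := by rw [← hb, hlast]
  rw [hsum, hsplit]
  have hga : g a = c (k + (a : ZMod (n + 1))) := rfl
  linarith

/-- Integral solutions of the Pohozaev identity at a fundamental weight are nonnegative. -/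
theorem nonneg_of_cyclic_form_eq (n : ℕ) (c : ZMod (n + 1) → ℤ) (j : ZMod (n + 1))
    (h : ∑ i, c i ^ 2 - ∑ i, c i * c (i + 1) = c j) (k : ZMod (n + 1)) : 0 ≤ c k := by
  have hshift : ∑ i, c (i + 1) ^ 2 = ∑ i, c i ^ 2 :=
    Equiv.sum_comp (Equiv.addRight (1 : ZMod (n + 1))) fun i => c i ^ 2
  have hsq : ∑ i, (c i - c (i + 1)) ^ 2 = 2 * c j := by
    have : ∑ i, (c i - c (i + 1)) ^ 2
        = ∑ i, c i ^ 2 + ∑ i, c (i + 1) ^ 2 - 2 * ∑ i, c i * c (i + 1) := by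
      rw [Finset.mul_sum, ← Finset.sum_add_distrib, ← Finset.sum_sub_distrib]
      exact Finset.sum_congr rfl fun i _ => by ring
    rw [this, hshift, ← h]
    ring
  have habs : ∑ i, |c i - c (i + 1)| ≤ ∑ i, (c i - c (i + 1)) ^ 2 :=
    Finset.sum_le_sum fun i _ => by
      rw [← sq_abs]
      exact Int.le_self_sq _
  linarith [two_mul_sub_le_sum_abs_sub n c j k]

theorem one_ne_zero_zmod_succ {n : ℕ} (hn : 2 ≤ n) : (1 : ZMod (n + 1)) ≠ 0 := by
  have : Fact (1 < n + 1) := ⟨by omega⟩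
  exact one_ne_zero

theorem one_add_one_ne_zero_zmod_succ {n : ℕ} (hn : 2 ≤ n) : (1 + 1 : ZMod (n + 1)) ≠ 0 := by
  intro h
  have h' : ((2 : ℕ) : ZMod (n + 1)) = 0 := by
    rw [← h]; norm_num
  rw [ZMod.natCast_eq_zero_iff] at h'
  have := Nat.le_of_dvd (by norm_num) h'
  omega

theorem sum_affA_mul {n : ℕ} (hn : 2 ≤ n)
    (σ : ZMod (n + 1) → MvPolynomial (ZMod (n + 1)) ℝ) (i : ZMod (n + 1)) :
    ∑ t, MvPolynomial.C (affA n i t) * σ t = 2 * σ i - σ (i - 1) - σ (i + 1) := by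
  have h1 := one_ne_zero_zmod_succ hn
  have h2 := one_add_one_ne_zero_zmod_succ hn
  have key : ∀ t, MvPolynomial.C (affA n i t) * σ t
      = (if t = i then 2 * σ t else 0) - (if t = i - 1 then σ t else 0)
        - (if t = i + 1 then σ t else 0) := by
    intro t
    unfold affA
    by_cases ha : t = i
    · subst ha
      have hb : t ≠ t - 1 := fun h => h1 (by linear_combination h)
      have hc : t ≠ t + 1 := fun h => h1 (by linear_combination -h)
      simp only [if_true, if_neg hb, if_neg hc, sub_zero, map_ofNat]
    · by_cases hb : t = i - 1
      · subst hb
        have hc : i - 1 ≠ i + 1 := fun h => h2 (by linear_combination -h)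
        have hd : i ≠ i - 1 := fun h => ha h.symm
        simp [ha, hc, hd]
      · by_cases hc : t = i + 1
        · subst hc
          have hd : i ≠ i + 1 := fun h => ha h.symm
          simp [ha, hb, hd]
        · have hd : i ≠ t + 1 := fun h => hb (by rw [h]; ring)
          have he : i ≠ t := fun h => ha h.symm
          simp [ha, hb, hc, hd, he]
  simp only [key, Finset.sum_sub_distrib, Finset.sum_ite_eq', Finset.mem_univ, if_true]

theorem reflAP_eq_update {n : ℕ} (hn : 2 ≤ n) (i : ZMod (n + 1))
    (σ : ZMod (n + 1) → MvPolynomial (ZMod (n + 1)) ℝ) :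
    reflAP n i σ = Function.update σ i
      (2 * MvPolynomial.X i - σ i + σ (i - 1) + σ (i + 1)) := by
  rw [reflAP, sum_affA_mul hn]
  congr 1
  ring

theorem reflAP_reflAP {n : ℕ} (hn : 2 ≤ n) (i : ZMod (n + 1))
    (σ : ZMod (n + 1) → MvPolynomial (ZMod (n + 1)) ℝ) :
    reflAP n i (reflAP n i σ) = σ := by
  have h1 := one_ne_zero_zmod_succ hn
  have hb : i - 1 ≠ i := fun h => h1 (by linear_combination -h)
  have hc : i + 1 ≠ i := fun h => h1 (by linear_combination h)
  simp only [reflAP_eq_update hn, Function.update_idem, Function.update_self,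
    Function.update_of_ne hb, Function.update_of_ne hc]
  convert Function.update_eq_self i σ using 2
  ring

/-- The Pohozaev identity is preserved by cyclic reflections. -/
theorem pohozaev_update {n : ℕ} (hn : 2 ≤ n) {S : Type*} [CommRing S]
    (x σ : ZMod (n + 1) → S) (i : ZMod (n + 1))
    (h : ∑ k, σ k ^ 2 - ∑ k, σ k * σ (k + 1) = 2 * ∑ k, x k * σ k) :
    ∑ k, (Function.update σ i (2 * x i - σ i + σ (i - 1) + σ (i + 1))) k ^ 2
      - ∑ k, (Function.update σ i (2 * x i - σ i + σ (i - 1) + σ (i + 1))) k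
          * (Function.update σ i (2 * x i - σ i + σ (i - 1) + σ (i + 1))) (k + 1)
      = 2 * ∑ k, x k * (Function.update σ i (2 * x i - σ i + σ (i - 1) + σ (i + 1))) k := by
  have h1 := one_ne_zero_zmod_succ hn
  set d := 2 * x i - 2 * σ i + σ (i - 1) + σ (i + 1) with hd
  set τ := Function.update σ i (2 * x i - σ i + σ (i - 1) + σ (i + 1)) with hτ
  have hτk : ∀ k, τ k = σ k + if k = i then d else 0 := by
    intro k
    by_cases hk : k = i
    · subst hk
      simp only [hτ, Function.update_self, if_true, hd]
      ring
    · simp [hτ, hk]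
  have e1 : ∑ k, τ k ^ 2 = ∑ k, σ k ^ 2 + (2 * σ i * d + d ^ 2) := by
    have : ∀ k, τ k ^ 2 = σ k ^ 2 + if k = i then 2 * σ k * d + d ^ 2 else 0 := by
      intro k
      rw [hτk]
      split_ifs <;> ring
    simp only [this, Finset.sum_add_distrib, Finset.sum_ite_eq', Finset.mem_univ, if_true]
  have e2 : ∑ k, τ k * τ (k + 1) = ∑ k, σ k * σ (k + 1) + d * σ (i + 1) + σ (i - 1) * d := by
    have : ∀ k, τ k * τ (k + 1) = σ k * σ (k + 1) + (if k = i then d * σ (k + 1) else 0)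
        + if k = i - 1 then σ k * d else 0 := by
      intro k
      rw [hτk, hτk]
      by_cases hk : k = i
      · subst hk
        have hb : k ≠ k - 1 := fun h => h1 (by linear_combination h)
        have hc : k + 1 ≠ k := fun h => h1 (by linear_combination h)
        simp only [if_true, if_neg hb, if_neg hc]
        ring
      · have hiff : k + 1 = i ↔ k = i - 1 := eq_sub_iff_add_eq.symm
        simp only [hiff, if_neg hk]
        split_ifs <;> ring
    simp only [this, Finset.sum_add_distrib, Finset.sum_ite_eq', Finset.mem_univ, if_true]
  have e3 : ∑ k, x k * τ k = ∑ k, x k * σ k + x i * d := by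
    simp only [hτk, mul_add, Finset.sum_add_distrib, mul_ite, mul_zero, Finset.sum_ite_eq',
      Finset.mem_univ, if_true]
  rw [e1, e2, e3]
  linear_combination h + d * hd

/-- The vector of linear forms `2 ∑_j N i j X_j` attached to an integral matrix `N`. -/
noncomputable def linForm (n : ℕ) (N : ZMod (n + 1) → ZMod (n + 1) → ℤ) (i : ZMod (n + 1)) :
    MvPolynomial (ZMod (n + 1)) ℝ :=
  2 * ∑ j, (N i j : MvPolynomial (ZMod (n + 1)) ℝ) * MvPolynomial.X j

/-- The Pohozaev identity for `linForm n N`. -/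
def Pohozaev (n : ℕ) (N : ZMod (n + 1) → ZMod (n + 1) → ℤ) : Prop :=
  ∑ i, linForm n N i ^ 2 - ∑ i, linForm n N i * linForm n N (i + 1)
    = 2 * ∑ i, MvPolynomial.X i * linForm n N i

/-- The reflection at `i` on integral coefficient matrices. -/
def reflMat (n : ℕ) (i : ZMod (n + 1)) (N : ZMod (n + 1) → ZMod (n + 1) → ℤ) :
    ZMod (n + 1) → ZMod (n + 1) → ℤ :=
  Function.update N i
    fun j => (if j = i then 1 else 0) - N i j + N (i - 1) j + N (i + 1) j

theorem linForm_reflMat {n : ℕ} (hn : 2 ≤ n) (i : ZMod (n + 1))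
    (N : ZMod (n + 1) → ZMod (n + 1) → ℤ) :
    linForm n (reflMat n i N) = reflAP n i (linForm n N) := by
  rw [reflAP_eq_update hn]
  funext k
  by_cases hk : k = i
  · subst hk
    simp only [Function.update_self, linForm, reflMat, Int.cast_add, Int.cast_sub, Int.cast_ite,
      Int.cast_one, Int.cast_zero, add_mul, sub_mul, ite_mul, one_mul, zero_mul,
      Finset.sum_add_distrib, Finset.sum_sub_distrib, Finset.sum_ite_eq', Finset.mem_univ, if_true]
    ring
  · simp [linForm, reflMat, hk]

theorem Pohozaev.reflMat {n : ℕ} (hn : 2 ≤ n) {N : ZMod (n + 1) → ZMod (n + 1) → ℤ}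
    (h : Pohozaev n N) (i : ZMod (n + 1)) : Pohozaev n (reflMat n i N) := by
  rw [Pohozaev, linForm_reflMat hn, reflAP_eq_update hn]
  exact pohozaev_update hn MvPolynomial.X (linForm n N) i h

theorem Pohozaev.eval {n : ℕ} {N : ZMod (n + 1) → ZMod (n + 1) → ℤ} (h : Pohozaev n N)
    (v : ZMod (n + 1) → ℤ) :
    ∑ i, (∑ j, N i j * v j) ^ 2 - ∑ i, (∑ j, N i j * v j) * (∑ j, N (i + 1) j * v j)
      = ∑ i, v i * ∑ j, N i j * v j := by
  have he := congrArg (MvPolynomial.eval fun j => (v j : ℝ)) h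
  simp only [linForm, map_sub, map_mul, map_sum, map_pow, map_intCast, map_ofNat,
    MvPolynomial.eval_X] at he
  have hi : ∑ i, (2 * ∑ j, N i j * v j) ^ 2
      - ∑ i, (2 * ∑ j, N i j * v j) * (2 * ∑ j, N (i + 1) j * v j)
      = 2 * ∑ i, v i * (2 * ∑ j, N i j * v j) := by exact_mod_cast he
  simp only [mul_pow, mul_mul_mul_comm (2 : ℤ), mul_left_comm _ (2 : ℤ), ← Finset.mul_sum] at hi
  linarith

theorem Pohozaev.nonneg {n : ℕ} {N : ZMod (n + 1) → ZMod (n + 1) → ℤ} (h : Pohozaev n N)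
    (i j : ZMod (n + 1)) : 0 ≤ N i j := by
  have he := h.eval fun k => if k = j then 1 else 0
  simp only [mul_ite, mul_one, mul_zero, ite_mul, one_mul, zero_mul, Finset.sum_ite_eq',
    Finset.mem_univ, if_true] at he
  exact nonneg_of_cyclic_form_eq n (fun i => N i j) j he i

/-- A nonzero solution has a reflection that strictly decreases the sum of its coefficients. -/
theorem Pohozaev.exists_sum_neg {n : ℕ} {N : ZMod (n + 1) → ZMod (n + 1) → ℤ}
    (h : Pohozaev n N) (hN : 0 < ∑ i, ∑ j, N i j) :
    ∃ i, 1 - 2 * ∑ j, N i j + ∑ j, N (i - 1) j + ∑ j, N (i + 1) j < 0 := by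
  by_contra! hcon
  have he := h.eval fun _ => 1
  simp only [mul_one, one_mul] at he
  have hs : ∀ i, 0 ≤ ∑ j, N i j := fun i => Finset.sum_nonneg fun j _ => h.nonneg i j
  have hshift : ∑ i, (∑ j, N i j) * (∑ j, N (i - 1) j)
      = ∑ i, (∑ j, N i j) * (∑ j, N (i + 1) j) := by
    rw [← Equiv.sum_comp (Equiv.addRight (1 : ZMod (n + 1)))]
    refine Finset.sum_congr rfl fun i _ => ?_
    simp only [Equiv.coe_addRight, add_sub_cancel_right]
    ring
  have hnn := Finset.sum_nonneg fun i (_ : i ∈ Finset.univ) => mul_nonneg (hs i) (hcon i)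
  have hexp : ∑ i, (∑ j, N i j)
        * (1 - 2 * ∑ j, N i j + ∑ j, N (i - 1) j + ∑ j, N (i + 1) j)
      = ∑ i, ∑ j, N i j - 2 * ∑ i, (∑ j, N i j) ^ 2
        + ∑ i, (∑ j, N i j) * (∑ j, N (i - 1) j)
        + ∑ i, (∑ j, N i j) * (∑ j, N (i + 1) j) := by
    rw [Finset.mul_sum Finset.univ (fun i => (∑ j, N i j) ^ 2), ← Finset.sum_sub_distrib,
      ← Finset.sum_add_distrib, ← Finset.sum_add_distrib]
    exact Finset.sum_congr rfl fun i _ => by ring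
  rw [hexp, hshift] at hnn
  linarith

theorem sum_reflMat (n : ℕ) (i : ZMod (n + 1)) (N : ZMod (n + 1) → ZMod (n + 1) → ℤ) :
    ∑ k, ∑ j, reflMat n i N k j = ∑ k, ∑ j, N k j
      + (1 - 2 * ∑ j, N i j + ∑ j, N (i - 1) j + ∑ j, N (i + 1) j) := by
  have key : ∀ k, ∑ j, reflMat n i N k j = ∑ j, N k j
      + if k = i then 1 - 2 * ∑ j, N i j + ∑ j, N (i - 1) j + ∑ j, N (i + 1) j else 0 := by
    intro k
    by_cases hk : k = i
    · subst hk
      simp only [reflMat, Function.update_self, Finset.sum_add_distrib, Finset.sum_sub_distrib,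
        Finset.sum_ite_eq', Finset.mem_univ, if_true]
      ring
    · simp [reflMat, hk]
  simp only [key, Finset.sum_add_distrib, Finset.sum_ite_eq', Finset.mem_univ, if_true]

theorem Pohozaev.gammaAP {n : ℕ} (hn : 2 ≤ n) {N : ZMod (n + 1) → ZMod (n + 1) → ℤ}
    (h : Pohozaev n N) : GammaAP n (linForm n N) := by
  induction hm : (∑ i, ∑ j, N i j).toNat using Nat.strong_induction_on generalizing N with
  | _ m ih =>
    have hs : ∀ i, 0 ≤ ∑ j, N i j := fun i => Finset.sum_nonneg fun j _ => h.nonneg i j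
    rcases (Finset.sum_nonneg fun i (_ : i ∈ Finset.univ) => hs i).eq_or_lt' with h0 | hpos
    · have hz : linForm n N = 0 := by
        funext i
        have hi := (Finset.sum_eq_zero_iff_of_nonneg fun i _ => hs i).1 h0 i (Finset.mem_univ i)
        have hij := (Finset.sum_eq_zero_iff_of_nonneg fun j _ => h.nonneg i j).1 hi
        simp [linForm, hij]
      rw [hz]
      exact GammaAP.zero
    · obtain ⟨i, hi⟩ := h.exists_sum_neg hpos
      have hg := ih _ (by rw [← hm, sum_reflMat]; omega) (h.reflMat hn i) rfl
      rw [linForm_reflMat hn] at hg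
      rw [← reflAP_reflAP hn i (linForm n N)]
      exact GammaAP.refl i _ hg

theorem GammaAP.exists_pohozaev {n : ℕ} (hn : 2 ≤ n)
    {σ : ZMod (n + 1) → MvPolynomial (ZMod (n + 1)) ℝ} (h : GammaAP n σ) :
    ∃ N, Pohozaev n N ∧ σ = linForm n N := by
  induction h with
  | zero => exact ⟨0, by simp [Pohozaev, linForm], by funext i; simp [linForm]⟩
  | refl i σ _ ih =>
    obtain ⟨N, hN, rfl⟩ := ih
    exact ⟨reflMat n i N, hN.reflMat hn i, (linForm_reflMat hn i N).symm⟩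

/-- `Γ_N`, the set of `σ ∈ R^{n+1}` whose components are `2 ∑_j N_{ij} X_j` with
`N_{ij} ∈ ℕ` and which satisfy the Pohozaev identity as polynomials, equals `Γ_A`. -/
theorem gammaN_eq_gammaAP (n : ℕ) (hn : 2 ≤ n) :
    {σ : ZMod (n + 1) → MvPolynomial (ZMod (n + 1)) ℝ |
      (∃ N : ZMod (n + 1) → ZMod (n + 1) → ℕ, ∀ i : ZMod (n + 1),
        σ i = 2 * ∑ j : ZMod (n + 1),
          ((N i j : MvPolynomial (ZMod (n + 1)) ℝ) * MvPolynomial.X j)) ∧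
      ∑ i : ZMod (n + 1), (σ i) ^ 2 - ∑ i : ZMod (n + 1), σ i * σ (i + 1)
        = 2 * ∑ i : ZMod (n + 1), MvPolynomial.X i * σ i}
    = {σ | GammaAP n σ} := by
  ext σ
  simp only [Set.mem_ofPred_eq]
  constructor
  · rintro ⟨⟨N, hN⟩, hP⟩
    obtain rfl : σ = linForm n fun i j => (N i j : ℤ) := by
      funext i
      simp [hN, linForm]
    exact Pohozaev.gammaAP hn hP
  · intro h
    obtain ⟨N, hN, rfl⟩ := h.exists_pohozaev hn
    lift N to ZMod (n + 1) → ZMod (n + 1) → ℕ using fun i j => hN.nonneg i j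
    exact ⟨⟨N, fun i => by simp [linForm]⟩, hN⟩
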